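/- Let f ∈ ℤ[x] be monic of degree n, and let H be an n×n nonsingular integer matrix in Hermite Normal Form (lower-triangular convention) whose rows span an ideal lattice for f. Let H_i(x) = Σ_{j=1}^{i} h_{i,j} x^{j−1} be the polynomial corresponding to the i-th row, and let β be the integer root of h_{2,1} + h_{2,2}x (which exists since h_{2,2} ∣ h_{2,1}). Then for every i with 2 ≤ i ≤ n, the integer h_{1,1}·h_{i,i}/h_{2,2} divides H_i(β). -/

import Mathlib

open Polynomial

/-- Coefficients of the polynomial attached to a coefficient vector. -/
theorem coeff_sum_C_mul_X_pow_fin {n : ℕ} (v : Fin n → ℤ) (j : Fin n) :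
    (∑ k : Fin n, C (v k) * X ^ (k : ℕ)).coeff (j : ℕ) = v j := by
  simp [coeff_X_pow, Fin.val_inj]

/-- A combination of the rows of a lower-triangular matrix with nonzero diagonal which vanishes
beyond the index `m` only involves rows up to `m`. -/
theorem coeff_eq_zero_of_lowerTriangular {n : ℕ} {H : Matrix (Fin n) (Fin n) ℤ}
    (hdiag : ∀ i, H i i ≠ 0) (hupper : ∀ j i : Fin n, j < i → H j i = 0)
    {c : Fin n → ℤ} {m : Fin n} (hc : ∀ j, m < j → ∑ k, c k * H k j = 0) :
    ∀ k, m < k → c k = 0 := by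
  intro k
  induction k using WellFoundedGT.induction with
  | ind k ih =>
    intro hk
    have h := hc k hk
    rw [Finset.sum_eq_single k] at h
    · exact (mul_eq_zero.mp h).resolve_right (hdiag k)
    · intro l _ hl
      rcases lt_or_gt_of_ne hl with h' | h'
      · rw [hupper l k h', mul_zero]
      · rw [ih l h' (hk.trans h'), zero_mul]
    · simp

/-- Multiplying the polynomial of row `i` by `X` gives a combination of the rows up to the next
one `m`, whose leading terms and values at `β` are related accordingly. -/
theorem exists_shift_row_combination {n : ℕ} {f : ℤ[X]} (hf : f.Monic) (hfdeg : f.natDegree = n)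
    {H : Matrix (Fin n) (Fin n) ℤ} (hdiag : ∀ i, H i i ≠ 0)
    (hupper : ∀ j i : Fin n, j < i → H j i = 0)
    (hclosed : ∀ v : Fin n → ℤ,
      v ∈ Submodule.span ℤ (Set.range fun i : Fin n => H i) →
      (fun j : Fin n => ((X * ∑ k : Fin n, C (v k) * X ^ (k : ℕ)) %ₘ f).coeff (j : ℕ))
        ∈ Submodule.span ℤ (Set.range fun i : Fin n => H i))
    (β : ℤ) (i m : Fin n) (hm : (m : ℕ) = i + 1) :
    ∃ c : Fin n → ℤ, (∀ k, m < k → c k = 0) ∧ c m * H m m = H i i ∧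
      ∑ k, c k * ∑ j : Fin n, H k j * β ^ (j : ℕ) = β * ∑ j : Fin n, H i j * β ^ (j : ℕ) := by
  set q : ℤ[X] := ∑ k : Fin n, C (H i k) * X ^ (k : ℕ) with hq
  have hqdeg : q.natDegree ≤ i := by
    refine natDegree_sum_le_of_forall_le _ _ fun k _ => ?_
    rcases lt_or_ge i k with h | h
    · simp [hupper i k h]
    · exact (natDegree_C_mul_X_pow_le _ _).trans h
  have hpdeg : (X * q).natDegree ≤ (m : ℕ) := by
    refine natDegree_mul_le.trans ?_
    rw [natDegree_X]
    omega
  have hmod : (X * q) %ₘ f = X * q :=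
    modByMonic_eq_self_iff hf |>.mpr <| degree_lt_degree (by have := m.2; omega)
  have hmem := hclosed (H i) (Submodule.subset_span ⟨i, rfl⟩)
  rw [← hq, hmod, Submodule.mem_span_range_iff_exists_fun] at hmem
  obtain ⟨c, hc⟩ := hmem
  have hcj (j : Fin n) : ∑ k, c k * H k j = (X * q).coeff j := by
    simpa using congrFun hc j
  have hzero : ∀ k, m < k → c k = 0 :=
    coeff_eq_zero_of_lowerTriangular hdiag hupper fun j hj => by
      rw [hcj, coeff_eq_zero_of_natDegree_lt (hpdeg.trans_lt hj)]
  refine ⟨c, hzero, ?_, ?_⟩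
  · have h := hcj m
    rw [hm, coeff_X_mul, hq, coeff_sum_C_mul_X_pow_fin, Finset.sum_eq_single m] at h
    · exact h
    · intro l _ hl
      rcases lt_or_gt_of_ne hl with h' | h'
      · rw [hupper l m h', mul_zero]
      · rw [hzero l h', zero_mul]
    · simp
  · calc ∑ k, c k * ∑ j : Fin n, H k j * β ^ (j : ℕ)
        = ∑ j : Fin n, (∑ k, c k * H k j) * β ^ (j : ℕ) := by
          simp_rw [Finset.mul_sum, Finset.sum_mul, mul_assoc]
          exact Finset.sum_comm
      _ = (X * q).eval β := by
          simp_rw [hcj]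
          rw [eval_eq_sum_range' (hpdeg.trans_lt m.2)]
          exact Fin.sum_univ_eq_sum_range (fun j => (X * q).coeff j * β ^ j) n
      _ = β * ∑ j : Fin n, H i j * β ^ (j : ℕ) := by
          simp [hq, eval_finsetSum]

/-- Let `H` be a nonsingular integer matrix in Hermite Normal Form
(lower-triangular convention) whose rows span an ideal lattice for a monic `f` of degree
`n`, let `H_i(x) = Σ_j h_{i,j} x^{j−1}` be the polynomial of the `i`-th row, and let `β`
be the integer root of `h_{2,1} + h_{2,2}·x`. Then for every `i` with `2 ≤ i ≤ n`
(0-indexed: `1 ≤ i`), the integer `h_{1,1}·h_{i,i}/h_{2,2}` divides `H_i(β)`. -/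
theorem hnf_ideal_lattice_row_poly_root
    (n : ℕ) (hn : 2 ≤ n)
    (f : Polynomial ℤ) (hf : f.Monic) (hfdeg : f.natDegree = n)
    (H : Matrix (Fin n) (Fin n) ℤ)
    (hdet : H.det ≠ 0)
    (hdiagpos : ∀ i : Fin n, 0 < H i i)
    (hupper : ∀ j i : Fin n, j < i → H j i = 0)
    (hreduced : ∀ i j : Fin n, i < j → 0 ≤ H j i ∧ H j i < H i i)
    (hclosed : ∀ v : Fin n → ℤ,
      v ∈ Submodule.span ℤ (Set.range fun i : Fin n => H i) →
      (fun j : Fin n => ((X * ∑ k : Fin n, C (v k) * X ^ (k : ℕ)) %ₘ f).coeff (j : ℕ))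
        ∈ Submodule.span ℤ (Set.range fun i : Fin n => H i))
    (β : ℤ)
    (hβ : H ⟨1, by omega⟩ ⟨0, by omega⟩ + H ⟨1, by omega⟩ ⟨1, by omega⟩ * β = 0) :
    ∀ i : Fin n, 1 ≤ (i : ℕ) →
      (H ⟨0, by omega⟩ ⟨0, by omega⟩ * H i i / H ⟨1, by omega⟩ ⟨1, by omega⟩) ∣
        ∑ j : Fin n, H i j * β ^ (j : ℕ) := by
  have hdiag (i : Fin n) : H i i ≠ 0 := (hdiagpos i).ne'
  have hstep := exists_shift_row_combination hf hfdeg hdiag hupper hclosed β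
  set r₀ : Fin n := ⟨0, by omega⟩ with hr₀
  set r₁ : Fin n := ⟨1, by omega⟩ with hr₁
  set E : Fin n → ℤ := fun k => ∑ j : Fin n, H k j * β ^ (j : ℕ) with hE
  have hE₀ : E r₀ = H r₀ r₀ := by
    rw [hE]
    dsimp only
    rw [Finset.sum_eq_single r₀]
    · simp [hr₀]
    · intro j _ hj
      rw [hupper r₀ j (Fin.lt_def.mpr (Nat.pos_of_ne_zero fun h => hj (Fin.ext h))), zero_mul]
    · simp
  have hE₁ : E r₁ = 0 := by
    rw [hE]
    dsimp only
    rw [Finset.sum_eq_add r₀ r₁ (by simp [hr₀, hr₁])]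
    · simpa [hr₀, hr₁] using hβ
    · intro j _ hj
      have h0 : (j : ℕ) ≠ 0 := fun h => hj.1 (Fin.ext h)
      have h1 : (j : ℕ) ≠ 1 := fun h => hj.2 (Fin.ext h)
      rw [hupper r₁ j (Fin.lt_def.mpr (by change 1 < (j : ℕ); omega)), zero_mul]
    · simp
    · simp
  obtain ⟨g, hg⟩ : H r₁ r₁ ∣ H r₀ r₀ := by
    obtain ⟨c, -, h, -⟩ := hstep r₀ r₁ rfl
    exact ⟨c r₁, by rw [← h, mul_comm]⟩
  have key : ∀ m : ℕ, 1 ≤ m → ∀ hm : m < n, ∀ k : Fin n, (k : ℕ) ≤ m →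
      g * H ⟨m, hm⟩ ⟨m, hm⟩ ∣ E k := by
    intro m hm1
    induction m, hm1 using Nat.le_induction with
    | base =>
      intro hm k hk
      have hk' : k = r₀ ∨ k = r₁ := by
        simp only [Fin.ext_iff, hr₀, hr₁]
        omega
      rcases hk' with rfl | rfl
      · rw [hE₀, hg, mul_comm]
      · rw [hE₁]
        exact dvd_zero _
    | succ m hm1 ih =>
      intro hm k hk
      have ih := ih (by omega)
      set i : Fin n := ⟨m, by omega⟩ with hi
      set s : Fin n := ⟨m + 1, hm⟩ with hs
      obtain ⟨c, hzero, hlead, hval⟩ := hstep i s rfl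
      rcases Nat.lt_or_ge m k with hlt | hle
      · obtain rfl : k = s := Fin.ext (by change (k : ℕ) = m + 1; omega)
        have hdvd : g * H i i ∣ c s * E s := by
          have hsum := Finset.add_sum_erase Finset.univ (fun k => c k * E k) (Finset.mem_univ s)
          rw [eq_sub_of_add_eq hsum]
          refine dvd_sub ?_ (Finset.dvd_sum fun l hl => ?_)
          · rw [hval]
            exact (ih i le_rfl).mul_left _
          · rcases lt_or_gt_of_ne (Finset.ne_of_mem_erase hl) with h | h
            · exact (ih l (Nat.le_of_lt_succ h)).mul_left _
            · simp [hzero l h]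
        have hcs : c s ≠ 0 := fun h => hdiag i (by rw [← hlead, h, zero_mul])
        rw [← hlead, mul_left_comm] at hdvd
        exact (mul_dvd_mul_iff_left hcs).mp hdvd
      · exact (mul_dvd_mul_left g ⟨c s, by rw [← hlead, mul_comm]⟩).trans (ih k hle)
  intro i hi
  have hquot : H r₀ r₀ * H i i / H r₁ r₁ = g * H i i := by
    rw [hg, mul_assoc, Int.mul_ediv_cancel_left _ (hdiag r₁)]
  rw [hquot]
  exact key i hi i.2 i le_rfl
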